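/- arXiv:1607.06335 — 2 statements merged into one kernel-verified Lean document; each statement's English description precedes it below -/
import Mathlib

section
/- Let β > 0, let (X, A_X) and (Y, A_Y) be finite networks, and let φ : X → Y be a dissimilarity reducing map, i.e., A_X(x,x') ≥ A_Y(φ(x), φ(x')) for all x, x' ∈ X. Then for all x, x' ∈ X, u^{R/NR}_X(x,x';β) ≥ u^{R/NR}_Y(φ(x),φ(x');β), i.e., the grafting method H^{R/NR}(β) satisfies the Axiom of Transformation. -/
noncomputable section

/-- Cost of a chain (a finite ordered list of nodes): the maximum dissimilarity
encountered over consecutive pairs (0 for chains with fewer than two nodes). -/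
def chainCost {X : Type*} (A : X → X → ℝ) : List X → ℝ
  | [] => 0
  | [_] => 0
  | a :: b :: rest => max (A a b) (chainCost A (b :: rest))

/-- The set of costs of chains from `x` to `x'`. -/
def chainCosts {X : Type*} (A : X → X → ℝ) (x x' : X) : Set ℝ :=
  { c | ∃ l : List X, l.head? = some x ∧ l.getLast? = some x' ∧ chainCost A l = c }

/-- Directed minimum chain cost ũ*(x,x'). -/
def minChainCost {X : Type*} (A : X → X → ℝ) (x x' : X) : ℝ :=
  sInf (chainCosts A x x')

/-- The reciprocal ultrametric u^R. -/
def uR {X : Type*} (A : X → X → ℝ) (x x' : X) : ℝ :=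
  minChainCost (fun a b => max (A a b) (A b a)) x x'

/-- The nonreciprocal ultrametric u^NR. -/
def uNR {X : Type*} (A : X → X → ℝ) (x x' : X) : ℝ :=
  max (minChainCost A x x') (minChainCost A x' x)

/-- The set of costs of chains from `x` to `x'` having at most `t` nodes. -/
def boundedChainCosts {X : Type*} (A : X → X → ℝ) (t : ℕ) (x x' : X) : Set ℝ :=
  { c | ∃ l : List X, l.head? = some x ∧ l.getLast? = some x' ∧ l.length ≤ t ∧
      chainCost A l = c }

/-- A^{SR(t)}(x,x'): minimum cost over chains from `x` to `x'` with at most `t` nodes. -/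
def ASR {X : Type*} (A : X → X → ℝ) (t : ℕ) (x x' : X) : ℝ :=
  sInf (boundedChainCosts A t x x')

/-- The semi-reciprocal ultrametric u^{SR(t)}. -/
def uSR {X : Type*} (A : X → X → ℝ) (t : ℕ) (x x' : X) : ℝ :=
  minChainCost (fun a b => max (ASR A t a b) (ASR A t b a)) x x'

/-- The grafted function u^{R/NR}(·,·;β). -/
def uRNR {X : Type*} (A : X → X → ℝ) (β : ℝ) (x x' : X) : ℝ :=
  if uR A x x' ≤ β then uNR A x x' else uR A x x'

theorem chainCost_le_iff {X : Type*} (A : X → X → ℝ) (c : ℝ) (l : List X) :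
    chainCost A l ≤ c ↔ 0 ≤ c ∧ l.IsChain (fun a b => A a b ≤ c) := by
  induction l using chainCost.induct with
  | case1 => simp [chainCost]
  | case2 => simp [chainCost]
  | case3 a b l ih =>
    rw [chainCost, max_le_iff, ih, List.isChain_cons_cons]
    tauto

theorem chainCost_nonneg {X : Type*} (A : X → X → ℝ) (l : List X) : 0 ≤ chainCost A l :=
  ((chainCost_le_iff A _ l).1 le_rfl).1

theorem chainCosts_nonempty {X : Type*} (A : X → X → ℝ) (x x' : X) :
    (chainCosts A x x').Nonempty :=
  ⟨_, [x, x'], rfl, rfl, rfl⟩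

theorem minChainCost_le {X : Type*} (A : X → X → ℝ) {x x' : X} {l : List X}
    (hx : l.head? = some x) (hx' : l.getLast? = some x') :
    minChainCost A x x' ≤ chainCost A l := by
  refine csInf_le ⟨0, ?_⟩ ⟨l, hx, hx', rfl⟩
  rintro _ ⟨m, -, -, rfl⟩
  exact chainCost_nonneg A m

/-- Maps that do not increase dissimilarities do not increase directed minimum chain costs. -/
theorem minChainCost_map_le {X Y : Type*} {A : X → X → ℝ} {B : Y → Y → ℝ} (φ : X → Y)
    (hφ : ∀ a b, B (φ a) (φ b) ≤ A a b) (x x' : X) :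
    minChainCost B (φ x) (φ x') ≤ minChainCost A x x' := by
  refine le_csInf (chainCosts_nonempty A x x') ?_
  rintro _ ⟨l, hx, hx', rfl⟩
  refine (minChainCost_le B (l := l.map φ) (by simp [hx]) (by simp [hx'])).trans ?_
  obtain ⟨h0, hl⟩ := (chainCost_le_iff A _ l).1 le_rfl
  rw [chainCost_le_iff, List.isChain_map]
  exact ⟨h0, hl.imp fun a b hab => (hφ a b).trans hab⟩

theorem minChainCost_swap_le {X : Type*} (A : X → X → ℝ) (x x' : X) :
    minChainCost (fun a b => A b a) x' x ≤ minChainCost A x x' := by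
  refine le_csInf (chainCosts_nonempty A x x') ?_
  rintro _ ⟨l, hx, hx', rfl⟩
  refine (minChainCost_le _ (l := l.reverse) (by simp [hx']) (by simp [hx])).trans ?_
  rw [chainCost_le_iff, List.isChain_reverse]
  exact (chainCost_le_iff A _ l).1 le_rfl

theorem uR_map_le {X Y : Type*} {A : X → X → ℝ} {B : Y → Y → ℝ} (φ : X → Y)
    (hφ : ∀ a b, B (φ a) (φ b) ≤ A a b) (x x' : X) : uR B (φ x) (φ x') ≤ uR A x x' :=
  minChainCost_map_le φ (fun a b => max_le_max (hφ a b) (hφ b a)) x x'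

theorem uNR_map_le {X Y : Type*} {A : X → X → ℝ} {B : Y → Y → ℝ} (φ : X → Y)
    (hφ : ∀ a b, B (φ a) (φ b) ≤ A a b) (x x' : X) : uNR B (φ x) (φ x') ≤ uNR A x x' :=
  max_le_max (minChainCost_map_le φ hφ x x') (minChainCost_map_le φ hφ x' x)

theorem uNR_le_uR {X : Type*} (A : X → X → ℝ) (x y : X) : uNR A x y ≤ uR A x y :=
  max_le (minChainCost_map_le id (fun _ _ => le_max_left _ _) x y)
    ((minChainCost_map_le id (fun _ _ => le_max_right _ _) y x).trans
      (minChainCost_swap_le _ x y))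

/-- the grafting method H^{R/NR}(β) satisfies the Axiom of
Transformation: dissimilarity reducing maps do not increase grafted ultrametrics. -/
theorem grafting_RNR_axiom_of_transformation {X Y : Type*} [Fintype X] [Fintype Y]
    (AX : X → X → ℝ) (AY : Y → Y → ℝ)
    (hnonnegX : ∀ x x' : X, 0 ≤ AX x x')
    (hidX : ∀ x x' : X, AX x x' = 0 ↔ x = x')
    (hnonnegY : ∀ y y' : Y, 0 ≤ AY y y')
    (hidY : ∀ y y' : Y, AY y y' = 0 ↔ y = y')
    (β : ℝ) (hβ : 0 < β)
    (φ : X → Y) (hφ : ∀ x x' : X, AY (φ x) (φ x') ≤ AX x x') :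
    ∀ x x' : X, uRNR AY β (φ x) (φ x') ≤ uRNR AX β x x' := by
  intro x x'
  have hR := uR_map_le φ hφ x x'
  have hNR := uNR_map_le φ hφ x x'
  have hY := uNR_le_uR AY (φ x) (φ x')
  unfold uRNR
  split_ifs <;> linarith
end
end

section
/- Let (X, A_X) be a finite network with n nodes, with dissimilarities arranged in the n×n matrix A_X. Then the reciprocal ultrametric can be computed via dioid matrix powers as u^{R}_X = (max(A_X, A_X^T))^{n−1}, where the maximum of matrices is taken entrywise and the power is the (n−1)-th dioid power in the min-max dioid algebra. -/
noncomputable section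

/-- The min-max dioid product of square matrices. -/
def dioidMul {n : ℕ} (A B : Fin n → Fin n → ℝ) : Fin n → Fin n → ℝ :=
  fun i j => ⨅ k : Fin n, max (A i k) (B k j)

/-- Dioid powers: `dioidPow A l` is the `l`-th power `A^l` of `A` in the min-max
dioid algebra (with the convention `A^0 = A`, which is never used for `l ≥ 1`). -/
def dioidPow {n : ℕ} (A : Fin n → Fin n → ℝ) : ℕ → Fin n → Fin n → ℝ
  | 0 => A
  | 1 => A
  | (k + 2) => dioidMul A (dioidPow A (k + 1))

theorem chainCost_le_cons {X : Type*} (A : X → X → ℝ) (a : X) (l : List X) :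
    chainCost A l ≤ chainCost A (a :: l) := by
  cases l with
  | nil => exact le_rfl
  | cons b r => exact le_max_right _ _

theorem chainCost_le_append {X : Type*} (A : X → X → ℝ) (s t : List X) :
    chainCost A t ≤ chainCost A (s ++ t) := by
  induction s with
  | nil => exact le_rfl
  | cons a s ih => exact ih.trans (chainCost_le_cons A a (s ++ t))

/-- Cutting out cycles turns any chain into one without repeated nodes, at no greater cost. -/
theorem exists_nodup_chainCost_le {X : Type*} (A : X → X → ℝ) (l : List X) :
    ∃ m : List X, m.Nodup ∧ m.head? = l.head? ∧ m.getLast? = l.getLast? ∧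
      chainCost A m ≤ chainCost A l := by
  induction l with
  | nil => exact ⟨[], by simp⟩
  | cons a l ih =>
    obtain ⟨m, hm, hh, hl, hc⟩ := ih
    cases l with
    | nil => exact ⟨[a], by simp⟩
    | cons b r =>
      obtain ⟨m', rfl⟩ : ∃ m', m = b :: m' := by
        cases m with
        | nil => simp at hh
        | cons c m' => exact ⟨m', by simpa using hh⟩
      by_cases ha : a ∈ b :: m'
      · obtain ⟨s, t, hst⟩ := List.append_of_mem ha
        rw [hst] at hm hl hc
        refine ⟨a :: t, (List.nodup_append.1 hm).2.1, rfl, ?_, ?_⟩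
        · rw [List.getLast?_cons_cons, ← hl, List.getLast?_append_cons]
        · exact (chainCost_le_append A s (a :: t)).trans
            (hc.trans (chainCost_le_cons A a (b :: r)))
      · refine ⟨a :: b :: m', List.nodup_cons.2 ⟨ha, hm⟩, rfl, ?_, max_le_max le_rfl hc⟩
        rw [List.getLast?_cons_cons, List.getLast?_cons_cons, hl]

theorem dioidMul_le {n : ℕ} (A B : Fin n → Fin n → ℝ) (i k j : Fin n) :
    dioidMul A B i j ≤ max (A i k) (B k j) :=
  ciInf_le (Set.finite_range fun k => max (A i k) (B k j)).bddBelow k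

theorem exists_dioidMul_eq {n : ℕ} (A B : Fin n → Fin n → ℝ) (i j : Fin n) :
    ∃ k, max (A i k) (B k j) = dioidMul A B i j :=
  haveI : Nonempty (Fin n) := ⟨i⟩
  exists_eq_ciInf_of_finite

theorem dioidPow_mem_chainCosts {n : ℕ} (A : Fin n → Fin n → ℝ) (hA : ∀ i j, 0 ≤ A i j)
    (k : ℕ) (i j : Fin n) : dioidPow A k i j ∈ chainCosts A i j := by
  have edge (i j : Fin n) : A i j ∈ chainCosts A i j :=
    ⟨[i, j], rfl, rfl, max_eq_left (hA i j)⟩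
  induction k generalizing i with
  | zero => exact edge i j
  | succ k ih =>
    cases k with
    | zero => exact edge i j
    | succ k =>
      obtain ⟨b, hb⟩ := exists_dioidMul_eq A (dioidPow A (k + 1)) i j
      obtain ⟨l, hh, hl, hc⟩ := ih b
      obtain ⟨r, rfl⟩ := List.head?_eq_some_iff.1 hh
      refine ⟨i :: b :: r, rfl, by rw [List.getLast?_cons_cons, hl], ?_⟩
      rw [chainCost, hc, hb, dioidPow]

theorem dioidPow_le_chainCost {n : ℕ} (A : Fin n → Fin n → ℝ) (hA : ∀ i, A i i = 0)
    (k : ℕ) (i j : Fin n) (l : List (Fin n)) (hh : l.head? = some i)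
    (hl : l.getLast? = some j) (hk : l.length ≤ k + 1) :
    dioidPow A k i j ≤ chainCost A l := by
  induction k generalizing i l with
  | zero =>
    obtain ⟨r, rfl⟩ := List.head?_eq_some_iff.1 hh
    obtain rfl : r = [] := by simpa using hk
    obtain rfl : i = j := by simpa using hl
    exact (hA i).le
  | succ k ih =>
    obtain ⟨r, rfl⟩ := List.head?_eq_some_iff.1 hh
    cases k with
    | zero =>
      match r with
      | [] =>
        obtain rfl : i = j := by simpa using hl
        exact (hA i).le
      | [b] =>
        obtain rfl : b = j := by simpa using hl
        exact le_max_left _ _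
      | _ :: _ :: _ => simp at hk
    | succ k =>
      cases r with
      | nil =>
        obtain rfl : i = j := by simpa using hl
        exact (dioidMul_le A _ i i i).trans (max_le (hA i).le (ih i [i] rfl rfl (by simp)))
      | cons b r =>
        rw [List.getLast?_cons_cons] at hl
        exact (dioidMul_le A _ i b j).trans
          (max_le_max le_rfl (ih b (b :: r) rfl hl (by simpa using hk)))

theorem isLeast_chainCosts_dioidPow {n : ℕ} (A : Fin n → Fin n → ℝ)
    (hA : ∀ i j, 0 ≤ A i j) (hA' : ∀ i, A i i = 0) (i j : Fin n) :
    IsLeast (chainCosts A i j) (dioidPow A (n - 1) i j) := by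
  refine ⟨dioidPow_mem_chainCosts A hA _ i j, ?_⟩
  rintro _ ⟨l, hh, hl, rfl⟩
  obtain ⟨m, hm, hmh, hml, hc⟩ := exists_nodup_chainCost_le A l
  have hlen : m.length ≤ n := by simpa using hm.length_le_card
  exact (dioidPow_le_chainCost A hA' _ i j m (hmh.trans hh) (hml.trans hl) (by omega)).trans hc

/-- the reciprocal ultrametric equals the (n−1)-th dioid power of
the entrywise maximum max(A, Aᵀ). -/
theorem reciprocal_eq_dioid_power (n : ℕ) (A : Fin n → Fin n → ℝ)
    (hnonneg : ∀ i j : Fin n, 0 ≤ A i j)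
    (hid : ∀ i j : Fin n, A i j = 0 ↔ i = j) :
    ∀ i j : Fin n,
      uR A i j = dioidPow (fun a b => max (A a b) (A b a)) (n - 1) i j := by
  intro i j
  exact (isLeast_chainCosts_dioidPow _ (fun a b => le_max_of_le_left (hnonneg a b))
    (fun a => by simpa using (hid a a).2 rfl) i j).csInf_eq
end
end
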